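/- The twisted identities are exactly the twisted involutions whose Coxeter length is twice their rank: ι(θ) = {w ∈ I(θ) : ℓ(w) = 2ρ(w)}. -/

import Mathlib

namespace TwistedIdentitiesPaper

open scoped Classical

variable {B : Type*} {W : Type*} [Group W] {M : CoxeterMatrix B}

/-- The Bruhat order on `W`, defined via the subword property: `u ≤ v` iff every
reduced expression for `v` contains a subword representing `u`. -/
def bruhatLE (cs : CoxeterSystem M W) (u v : W) : Prop :=
  ∀ l : List B, cs.IsReduced l → cs.wordProd l = v →
    ∃ l' : List B, l'.Sublist l ∧ cs.wordProd l' = u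

/-- The strict Bruhat order. -/
def bruhatLT (cs : CoxeterSystem M W) (u v : W) : Prop :=
  bruhatLE cs u v ∧ u ≠ v

/-- The action `w ↦ w ⋅ s̲ᵢ`: `w ⋅ s̲ᵢ = w sᵢ` if `θ(sᵢ) w sᵢ = w`, and
`w ⋅ s̲ᵢ = θ(sᵢ) w sᵢ` otherwise. -/
noncomputable def twistAct (cs : CoxeterSystem M W) (θ : W ≃* W) (w : W) (i : B) : W :=
  if θ (cs.simple i) * w * cs.simple i = w then w * cs.simple i
  else θ (cs.simple i) * w * cs.simple i

/-- `e ⋅ s̲₁ ⋯ s̲ₖ` for a word `s₁ ⋯ sₖ`. -/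
noncomputable def twistProd (cs : CoxeterSystem M W) (θ : W ≃* W) (l : List B) : W :=
  l.foldl (twistAct cs θ) 1

/-- The set of twisted involutions `I(θ) = {w : θ(w) = w⁻¹}`. -/
def twistedInvolutions (θ : W ≃* W) : Set W := {w | θ w = w⁻¹}

/-- The set of twisted identities `ι(θ) = {θ(w⁻¹) w : w ∈ W}`. -/
def twistedIdentities (θ : W ≃* W) : Set W := {w | ∃ v : W, w = θ v⁻¹ * v}

/-- The rank `ρ(w)` of a twisted involution: the least `k` such that
`w = e ⋅ s̲₁ ⋯ s̲ₖ`. -/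
noncomputable def twistRank (cs : CoxeterSystem M W) (θ : W ≃* W) (w : W) : ℕ :=
  sInf {k | ∃ l : List B, l.length = k ∧ twistProd cs θ l = w}

/-- `θ` has the no-odd-flip (NOF) property: for every `s ∈ S` with `θ(s) ≠ s`,
the order of `s θ(s)` is even or infinite. -/
def NOF (cs : CoxeterSystem M W) (θ : W ≃* W) : Prop :=
  ∀ i : B, θ (cs.simple i) ≠ cs.simple i →
    Even (orderOf (cs.simple i * θ (cs.simple i))) ∨
      orderOf (cs.simple i * θ (cs.simple i)) = 0

/-- The action of a generator on `W × ZMod 2` that conjugates the first coordinate and flips the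
second one exactly at the generator itself. -/
noncomputable def signedConj (cs : CoxeterSystem M W) (i : B) : Function.End (W × ZMod 2) :=
  fun p ↦ (cs.simple i * p.1 * cs.simple i, p.2 + if p.1 = cs.simple i then 1 else 0)

theorem prod_map_signedConj_apply (cs : CoxeterSystem M W) (l : List B) (p : W × ZMod 2) :
    (l.map (signedConj cs)).prod p =
      (cs.wordProd l * p.1 * (cs.wordProd l)⁻¹, p.2 + ((cs.rightInvSeq l).count p.1 : ZMod 2)) := by
  induction l with
  | nil => simp [Function.End.one_def]
  | cons i l ih =>
    rw [List.map_cons, List.prod_cons]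
    change signedConj cs i ((l.map (signedConj cs)).prod p) = _
    have h : cs.wordProd l * p.1 * (cs.wordProd l)⁻¹ = cs.simple i ↔
        (cs.wordProd l)⁻¹ * cs.simple i * cs.wordProd l = p.1 := by
      constructor
      · intro h; rw [← h]; group
      · intro h; rw [← h]; group
    rw [ih]
    simp only [signedConj, h, CoxeterSystem.rightInvSeq, List.count_cons, beq_iff_eq,
      CoxeterSystem.wordProd_cons, mul_inv_rev, CoxeterSystem.inv_simple]
    split_ifs <;> simp [add_assoc, mul_assoc]

theorem even_count_leftInvSeq_alternatingWord (cs : CoxeterSystem M W) (i j : B) (t : W) :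
    Even ((cs.leftInvSeq (CoxeterSystem.alternatingWord i j (2 * M i j))).count t) := by
  have h : cs.leftInvSeq (CoxeterSystem.alternatingWord i j (2 * M i j)) =
      (List.range (M i j + M i j)).map
        (fun k ↦ cs.wordProd (CoxeterSystem.alternatingWord j i (2 * k + 1))) := by
    apply List.ext_getElem
    · simp [two_mul]
    · intro k h₁ h₂
      rw [cs.getElem_leftInvSeq_alternatingWord i j _ k (by simpa using h₁)]
      simp
  have hper : ∀ k, cs.wordProd (CoxeterSystem.alternatingWord j i (2 * (M i j + k) + 1)) =
      cs.wordProd (CoxeterSystem.alternatingWord j i (2 * k + 1)) := by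
    intro k
    simp only [CoxeterSystem.prod_alternatingWord_eq_mul_pow]
    have h₁ : (2 * (M i j + k) + 1) / 2 = M i j + k := by omega
    have h₂ : (2 * k + 1) / 2 = k := by omega
    rw [h₁, h₂, pow_add, CoxeterSystem.simple_mul_simple_pow']
    simp [parity_simps]
  rw [h, List.range_add, List.map_append, List.map_map]
  simp only [Function.comp_def, hper, List.count_append]
  exact ⟨_, rfl⟩

theorem signedConj_mul_pow (cs : CoxeterSystem M W) (i j : B) (m : ℕ) :
    (signedConj cs i * signedConj cs j) ^ m =
      ((CoxeterSystem.alternatingWord j i (2 * m)).reverse.map (signedConj cs)).prod := by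
  induction m with
  | zero => simp [CoxeterSystem.alternatingWord]
  | succ m ih =>
    rw [pow_succ', ih, mul_add, mul_one, CoxeterSystem.alternatingWord_succ,
      CoxeterSystem.alternatingWord_succ]
    simp [mul_assoc]

theorem isLiftable_signedConj (cs : CoxeterSystem M W) : M.IsLiftable (signedConj cs) := by
  intro i j
  funext p
  have h := even_count_leftInvSeq_alternatingWord cs j i p.1
  rw [M.symmetric j i] at h
  rw [signedConj_mul_pow, prod_map_signedConj_apply, CoxeterSystem.rightInvSeq_reverse,
    List.count_reverse, (ZMod.natCast_eq_zero_iff_even).2 h, CoxeterSystem.wordProd_reverse,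
    CoxeterSystem.prod_alternatingWord_eq_mul_pow]
  simp [Function.End.one_def]

/-- The parity of the multiplicity of `t` in the right inversion sequence of any word for `w`. -/
noncomputable def invParity (cs : CoxeterSystem M W) (w t : W) : ZMod 2 :=
  (cs.lift ⟨signedConj cs, isLiftable_signedConj cs⟩ w (t, 0)).2

theorem lift_signedConj_wordProd (cs : CoxeterSystem M W) (l : List B) :
    cs.lift ⟨signedConj cs, isLiftable_signedConj cs⟩ (cs.wordProd l) =
      (l.map (signedConj cs)).prod := by
  induction l with
  | nil => simp
  | cons i l ih => rw [CoxeterSystem.wordProd_cons, map_mul, ih]; simp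

theorem invParity_wordProd (cs : CoxeterSystem M W) (l : List B) (t : W) :
    invParity cs (cs.wordProd l) t = ((cs.rightInvSeq l).count t : ZMod 2) := by
  simp [invParity, lift_signedConj_wordProd, prod_map_signedConj_apply]

theorem invParity_one (cs : CoxeterSystem M W) (t : W) : invParity cs 1 t = 0 := by
  simpa using invParity_wordProd cs [] t

theorem invParity_mul (cs : CoxeterSystem M W) (x y t : W) :
    invParity cs (x * y) t = invParity cs y t + invParity cs x (y * t * y⁻¹) := by
  obtain ⟨l, rfl⟩ := cs.wordProd_surjective x
  obtain ⟨l', rfl⟩ := cs.wordProd_surjective y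
  simp only [invParity, map_mul, lift_signedConj_wordProd]
  change ((l.map (signedConj cs)).prod ((l'.map (signedConj cs)).prod (t, 0))).2 = _
  simp [prod_map_signedConj_apply]

theorem invParity_eq_one_of_isRightDescent (cs : CoxeterSystem M W) {w : W} {i : B}
    (h : cs.IsRightDescent w i) : invParity cs w (cs.simple i) = 1 := by
  obtain ⟨l, hl, hw⟩ := cs.exists_isReduced (w * cs.simple i)
  have hw' : w = cs.wordProd (l.concat i) := by
    rw [CoxeterSystem.wordProd_concat, ← hw]; simp
  have hred : cs.IsReduced (l.concat i) := by
    have := cs.isRightDescent_iff.1 h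
    have hl' := hl.eq
    rw [← hw] at hl'
    rw [CoxeterSystem.IsReduced, ← hw']
    simp; omega
  rw [hw', invParity_wordProd, List.count_eq_one_of_mem hred.nodup_rightInvSeq]
  · simp
  · rw [CoxeterSystem.rightInvSeq_concat]; simp

theorem mem_rightInvSeq_of_isRightDescent (cs : CoxeterSystem M W) {l : List B} {i : B}
    (h : cs.IsRightDescent (cs.wordProd l) i) : cs.simple i ∈ cs.rightInvSeq l := by
  by_contra hn
  have := invParity_eq_one_of_isRightDescent cs h
  rw [invParity_wordProd, List.count_eq_zero_of_not_mem hn] at this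
  simp at this

theorem length_simple_mul_mul_simple (cs : CoxeterSystem M W) {w : W} {i j : B}
    (hi : cs.IsLeftDescent w i) (hj : cs.IsRightDescent w j)
    (hne : cs.simple i * w * cs.simple j ≠ w) :
    cs.length (cs.simple i * w * cs.simple j) + 2 = cs.length w := by
  obtain ⟨l, hl, hw⟩ := cs.exists_isReduced (cs.simple i * w)
  have hw' : w = cs.wordProd (i :: l) := by
    rw [CoxeterSystem.wordProd_cons, ← hw]; simp
  have hi' := cs.isLeftDescent_iff.1 hi
  have hl' := hl.eq
  rw [← hw] at hl'
  have hmem := mem_rightInvSeq_of_isRightDescent cs (hw' ▸ hj)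
  rw [CoxeterSystem.rightInvSeq, List.mem_cons] at hmem
  rcases hmem with hmem | hmem
  · refine absurd ?_ hne
    rw [hmem, hw', CoxeterSystem.wordProd_cons]
    simp [mul_assoc]
  · obtain ⟨k, hk, hkeq⟩ := List.getElem_of_mem hmem
    have he := cs.wordProd_mul_getD_rightInvSeq l k
    rw [List.getD_eq_getElem _ _ hk, hkeq, ← hw] at he
    have hle := cs.length_wordProd_le (l.eraseIdx k)
    rw [← he] at hle
    have hk' : k < l.length := by simpa using hk
    rw [List.length_eraseIdx_of_lt hk'] at hle
    have := cs.length_mul_simple (cs.simple i * w) j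
    omega

section Automorphism

variable (cs : CoxeterSystem M W) (θ : W ≃* W) (φ : B → B)

theorem map_wordProd_of_simple (hφ : ∀ i, θ (cs.simple i) = cs.simple (φ i)) (l : List B) :
    θ (cs.wordProd l) = cs.wordProd (l.map φ) := by
  induction l with
  | nil => simp
  | cons i l ih => simp [CoxeterSystem.wordProd_cons, ih, hφ]

theorem rightInvSeq_map_of_simple (hφ : ∀ i, θ (cs.simple i) = cs.simple (φ i)) (l : List B) :
    cs.rightInvSeq (l.map φ) = (cs.rightInvSeq l).map θ := by
  induction l with
  | nil => simp
  | cons i l ih =>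
    simp [CoxeterSystem.rightInvSeq, ih, hφ, map_wordProd_of_simple cs θ φ hφ]

theorem invParity_map_of_simple (hφ : ∀ i, θ (cs.simple i) = cs.simple (φ i)) (w t : W) :
    invParity cs (θ w) (θ t) = invParity cs w t := by
  obtain ⟨l, rfl⟩ := cs.wordProd_surjective w
  rw [map_wordProd_of_simple cs θ φ hφ, invParity_wordProd, invParity_wordProd,
    rightInvSeq_map_of_simple cs θ φ hφ, List.count_map_of_injective _ _ θ.injective]

theorem length_map_le_of_simple (hφ : ∀ i, θ (cs.simple i) = cs.simple (φ i)) (w : W) :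
    cs.length (θ w) ≤ cs.length w := by
  obtain ⟨l, hl, rfl⟩ := cs.exists_isReduced w
  rw [map_wordProd_of_simple cs θ φ hφ, hl.eq]
  simpa using cs.length_wordProd_le (l.map φ)

theorem length_map_of_simple (hθ : Function.Involutive θ)
    (hφ : ∀ i, θ (cs.simple i) = cs.simple (φ i)) (w : W) :
    cs.length (θ w) = cs.length w := by
  refine (length_map_le_of_simple cs θ φ hφ w).antisymm ?_
  simpa [hθ w] using length_map_le_of_simple cs θ φ hφ (θ w)

theorem isLeftDescent_of_isRightDescent (hθ : Function.Involutive θ)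
    (hφ : ∀ i, θ (cs.simple i) = cs.simple (φ i)) {w : W} (hw : θ w = w⁻¹) {i : B}
    (h : cs.IsRightDescent w i) : cs.IsLeftDescent w (φ i) := by
  have : cs.simple (φ i) * w = (θ (w * cs.simple i))⁻¹ := by simp [hw, hφ]
  rw [CoxeterSystem.IsLeftDescent, this, cs.length_inv, length_map_of_simple cs θ φ hθ hφ]
  exact h

theorem map_simple_mul_mul_simple_ne (hφ : ∀ i, θ (cs.simple i) = cs.simple (φ i)) (v : W) {i : B}
    (h : cs.IsRightDescent (θ v⁻¹ * v) i) :
    θ (cs.simple i) * (θ v⁻¹ * v) * cs.simple i ≠ θ v⁻¹ * v := by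
  intro he
  have hfix : θ (v * cs.simple i * v⁻¹) = v * cs.simple i * v⁻¹ := by
    have hs : θ (cs.simple i) * θ (cs.simple i) = 1 := by rw [← map_mul]; simp
    have he' : θ v⁻¹ * v * cs.simple i = θ (cs.simple i) * (θ v⁻¹ * v) := by
      calc θ v⁻¹ * v * cs.simple i
          = (θ (cs.simple i) * θ (cs.simple i)) * (θ v⁻¹ * v * cs.simple i) := by rw [hs, one_mul]
        _ = θ (cs.simple i) * (θ (cs.simple i) * (θ v⁻¹ * v) * cs.simple i) := by group
        _ = _ := by rw [he]
    calc θ (v * cs.simple i * v⁻¹)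
        = θ v * (θ (cs.simple i) * (θ v⁻¹ * v)) * v⁻¹ := by simp [mul_assoc]
      _ = θ v * (θ v⁻¹ * v * cs.simple i) * v⁻¹ := by rw [he']
      _ = _ := by simp [mul_assoc]
  have h₁ := invParity_eq_one_of_isRightDescent cs h
  have h₂ := invParity_mul cs v⁻¹ v (cs.simple i)
  rw [inv_mul_cancel, invParity_one] at h₂
  rw [invParity_mul, ← hfix, invParity_map_of_simple cs θ φ hφ, ← h₂] at h₁
  exact zero_ne_one h₁

theorem exists_twistProd_eq (hθ : Function.Involutive θ)
    (hφ : ∀ i, θ (cs.simple i) = cs.simple (φ i)) (v : W) :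
    ∃ l : List B, twistProd cs θ l = θ v⁻¹ * v ∧ 2 * l.length = cs.length (θ v⁻¹ * v) := by
  induction hn : cs.length (θ v⁻¹ * v) using Nat.strong_induction_on generalizing v with
  | _ n ih =>
  by_cases h1 : θ v⁻¹ * v = 1
  · refine ⟨[], by rw [h1]; rfl, ?_⟩
    rw [← hn, h1]; simp
  · obtain ⟨i, hi⟩ := cs.exists_rightDescent_of_ne_one h1
    have hne := map_simple_mul_mul_simple_ne cs θ φ hφ v hi
    have hinv : θ (θ v⁻¹ * v) = (θ v⁻¹ * v)⁻¹ := by simp [hθ v]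
    have hlen := length_simple_mul_mul_simple cs
      (isLeftDescent_of_isRightDescent cs θ φ hθ hφ hinv hi) hi (by rwa [← hφ])
    have hstep : θ (v * cs.simple i)⁻¹ * (v * cs.simple i) =
        θ (cs.simple i) * (θ v⁻¹ * v) * cs.simple i := by
      simp only [mul_inv_rev, CoxeterSystem.inv_simple, map_mul, mul_assoc]
    rw [← hφ, ← hstep] at hlen
    obtain ⟨l, hl, hlen'⟩ := ih _ (by omega) (v * cs.simple i) rfl
    refine ⟨l ++ [i], ?_, by simp; omega⟩
    have hs : θ (cs.simple i) * θ (cs.simple i) = 1 := by rw [← map_mul]; simp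
    have hback : θ (cs.simple i) * (θ (v * cs.simple i)⁻¹ * (v * cs.simple i)) * cs.simple i =
        θ v⁻¹ * v := by
      rw [hstep]
      simp only [← mul_assoc, hs, one_mul, CoxeterSystem.simple_mul_simple_cancel_right]
    have hact : twistProd cs θ (l ++ [i]) = twistAct cs θ (twistProd cs θ l) i := by
      simp [twistProd]
    rw [hact, hl, twistAct, hback, if_neg]
    rw [hstep]
    exact hne.symm

theorem length_twistProd_le (hφ : ∀ i, θ (cs.simple i) = cs.simple (φ i)) (l : List B) :
    cs.length (twistProd cs θ l) ≤ 2 * l.length ∧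
      (cs.length (twistProd cs θ l) = 2 * l.length → twistProd cs θ l ∈ twistedIdentities θ) := by
  induction l using List.reverseRecOn with
  | nil => exact ⟨by simp [twistProd], fun _ ↦ ⟨1, by simp [twistProd]⟩⟩
  | append_singleton l i ih =>
    have hact : twistProd cs θ (l ++ [i]) = twistAct cs θ (twistProd cs θ l) i := by
      simp [twistProd]
    obtain ⟨ih₁, ih₂⟩ := ih
    rw [hact, twistAct, List.length_append, List.length_singleton]
    split_ifs
    · have := cs.length_mul_simple (twistProd cs θ l) i
      exact ⟨by omega, fun h ↦ by omega⟩
    · have h₁ := cs.length_simple_mul (twistProd cs θ l) (φ i)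
      have h₂ := cs.length_mul_simple (cs.simple (φ i) * twistProd cs θ l) i
      rw [← hφ] at h₁ h₂
      refine ⟨by omega, fun h ↦ ?_⟩
      obtain ⟨v, hv⟩ := ih₂ (by omega)
      exact ⟨v * cs.simple i, by rw [hv]; simp [mul_assoc]⟩

end Automorphism

theorem statement1 [Finite B] (cs : CoxeterSystem M W) (θ : W ≃* W)
    (hθ : Function.Involutive θ)
    (hθS : ∀ i : B, ∃ j : B, θ (cs.simple i) = cs.simple j) :
    twistedIdentities θ =
      {w | w ∈ twistedInvolutions θ ∧ cs.length w = 2 * twistRank cs θ w} := by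
  choose φ hφ using hθS
  ext w
  constructor
  · rintro ⟨v, rfl⟩
    refine ⟨by simp [twistedInvolutions, hθ v], ?_⟩
    obtain ⟨l, hl, hlen⟩ := exists_twistProd_eq cs θ φ hθ hφ v
    rw [← hlen]
    congr 1
    refine (IsLeast.csInf_eq (s := {k | ∃ l : List B, l.length = k ∧ twistProd cs θ l = _})
      ⟨⟨l, rfl, hl⟩, ?_⟩).symm
    rintro _ ⟨l', rfl, hl'⟩
    have := (length_twistProd_le cs θ φ hφ l').1
    rw [hl'] at this
    omega
  · rintro ⟨-, hw⟩
    by_cases hne : {k | ∃ l : List B, l.length = k ∧ twistProd cs θ l = w}.Nonempty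
    · obtain ⟨l, hl, rfl⟩ := Nat.sInf_mem hne
      exact (length_twistProd_le cs θ φ hφ l).2 (by rw [hw, hl, twistRank])
    · rw [twistRank, Set.not_nonempty_iff_eq_empty.1 hne, Nat.sInf_empty, mul_zero,
        cs.length_eq_zero_iff] at hw
      exact ⟨1, by simp [hw]⟩

end TwistedIdentitiesPaper
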